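/- Let X be an n×k real matrix of rank k (k < n), R a q×k real matrix of rank q, and r ∈ R^q. Let N be a closed subset of R^n invariant under all maps y ↦ δy + Xη (δ ≠ 0, η ∈ R^k), and let β̌ : R^n \ N → R^k and Ω̌ : R^n \ N → R^{q×q} satisfy β̌(δy + Xη) = δβ̌(y) + η and Ω̌(δy + Xη) = δ²Ω̌(y) for all y ∈ R^n \ N, δ ≠ 0, η ∈ R^k. Define N* = N ∪ {y ∈ R^n \ N : det Ω̌(y) = 0} and T(y) = (Rβ̌(y) − r)' Ω̌(y)^{-1} (Rβ̌(y) − r) for y ∉ N*, T(y) = 0 for y ∈ N*. Then N* is invariant under all maps y ↦ δy + Xη (δ ≠ 0, η ∈ R^k), and T is G(M₀)-invariant: T(δ(y − μ₀) + μ₀') = T(y) for every y ∈ R^n, every δ ≠ 0, and all μ₀, μ₀' ∈ M₀ := {Xβ : Rβ = r}, provided M₀ is nonempty. -/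

import Mathlib

open Matrix

/-- A set stable under all maps `y ↦ δ • y + X η` with `δ ≠ 0` has a stable complement as well. -/
theorem smul_add_mulVec_mem_iff {m p : Type*} [Fintype p] {X : Matrix m p ℝ} {N : Set (m → ℝ)}
    (hN : ∀ y ∈ N, ∀ δ : ℝ, δ ≠ 0 → ∀ η : p → ℝ, δ • y + X.mulVec η ∈ N)
    (y : m → ℝ) {δ : ℝ} (hδ : δ ≠ 0) (η : p → ℝ) :
    δ • y + X.mulVec η ∈ N ↔ y ∈ N := by
  refine ⟨fun h => ?_, fun h => hN y h δ hδ η⟩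
  have hback := hN _ h δ⁻¹ (inv_ne_zero hδ) (-(δ⁻¹ • η))
  rwa [mulVec_neg, mulVec_smul, smul_add, smul_smul, inv_mul_cancel₀ hδ, one_smul,
    add_neg_cancel_right] at hback

/-- The quadratic form `vᵀ A⁻¹ v` is unchanged when `v` is scaled by `δ` and `A` by `δ ^ 2`. -/
theorem dotProduct_inv_mulVec_smul {m : Type*} [Fintype m] [DecidableEq m]
    {A : Matrix m m ℝ} (hA : A.det ≠ 0) (v : m → ℝ) {δ : ℝ} (hδ : δ ≠ 0) :
    (δ • v) ⬝ᵥ (δ ^ 2 • A)⁻¹.mulVec (δ • v) = v ⬝ᵥ A⁻¹.mulVec v := by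
  have hinv : (δ ^ 2 • A)⁻¹ = (δ ^ 2)⁻¹ • A⁻¹ := by
    refine inv_eq_right_inv ?_
    rw [smul_mul_smul_comm, mul_inv_cancel₀ (pow_ne_zero 2 hδ), one_smul,
      mul_nonsing_inv _ hA.isUnit]
  rw [hinv, smul_mulVec, mulVec_smul, smul_dotProduct, dotProduct_smul, dotProduct_smul]
  simp only [smul_eq_mul]
  field_simp

open Classical in
theorem stmt_6 {n k q : ℕ} (hkn : k < n) (hq : 1 ≤ q)
    (X : Matrix (Fin n) (Fin k) ℝ) (hX : X.rank = k)
    (R : Matrix (Fin q) (Fin k) ℝ) (hR : R.rank = q) (r : Fin q → ℝ)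
    (N : Set (Fin n → ℝ)) (hNclosed : IsClosed N)
    (hNinv : ∀ y ∈ N, ∀ (δ : ℝ), δ ≠ 0 → ∀ η : Fin k → ℝ, δ • y + X.mulVec η ∈ N)
    (βc : (Fin n → ℝ) → (Fin k → ℝ)) (Ωc : (Fin n → ℝ) → Matrix (Fin q) (Fin q) ℝ)
    (hβ : ∀ y ∉ N, ∀ (δ : ℝ), δ ≠ 0 → ∀ η : Fin k → ℝ,
      βc (δ • y + X.mulVec η) = δ • βc y + η)
    (hΩ : ∀ y ∉ N, ∀ (δ : ℝ), δ ≠ 0 → ∀ η : Fin k → ℝ,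
      Ωc (δ • y + X.mulVec η) = δ ^ 2 • Ωc y)
    (Nstar : Set (Fin n → ℝ))
    (hNstar : Nstar = N ∪ {y | y ∉ N ∧ (Ωc y).det = 0})
    (T : (Fin n → ℝ) → ℝ)
    (hT : ∀ y, T y = if y ∈ Nstar then 0 else
      (R.mulVec (βc y) - r) ⬝ᵥ (Ωc y)⁻¹.mulVec (R.mulVec (βc y) - r))
    (hM0 : ∃ β : Fin k → ℝ, R.mulVec β = r) :
    (∀ (y : Fin n → ℝ) (δ : ℝ), δ ≠ 0 → ∀ η : Fin k → ℝ,
      (δ • y + X.mulVec η ∈ Nstar ↔ y ∈ Nstar)) ∧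
    (∀ (y : Fin n → ℝ) (δ : ℝ), δ ≠ 0 → ∀ β₀ β₀' : Fin k → ℝ,
      R.mulVec β₀ = r → R.mulVec β₀' = r →
      T (δ • (y - X.mulVec β₀) + X.mulVec β₀') = T y) := by
  have hmem : ∀ (y : Fin n → ℝ) (δ : ℝ), δ ≠ 0 → ∀ η : Fin k → ℝ,
      (δ • y + X.mulVec η ∈ Nstar ↔ y ∈ Nstar) := by
    intro y δ hδ η
    have hN := smul_add_mulVec_mem_iff hNinv y hδ η
    by_cases hy : y ∈ N
    · simp [hNstar, hN, hy]
    · simp [hNstar, hN, hy, hΩ y hy δ hδ η, hδ]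
  refine ⟨hmem, fun y δ hδ β₀ β₀' h₀ h₀' => ?_⟩
  have harg : δ • (y - X.mulVec β₀) + X.mulVec β₀' = δ • y + X.mulVec (β₀' - δ • β₀) := by
    rw [mulVec_sub, mulVec_smul, smul_sub]
    abel
  rw [harg, hT, hT y]
  by_cases hy : y ∈ Nstar
  · rw [if_pos ((hmem y δ hδ _).2 hy), if_pos hy]
  · rw [if_neg (mt (hmem y δ hδ _).1 hy), if_neg hy]
    obtain ⟨hyN, hdet⟩ : y ∉ N ∧ (Ωc y).det ≠ 0 := by
      rw [hNstar] at hy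
      exact ⟨fun h => hy (Or.inl h), fun h => hy (Or.inr ⟨fun h' => hy (Or.inl h'), h⟩)⟩
    have hres : R.mulVec (δ • βc y + (β₀' - δ • β₀)) - r = δ • (R.mulVec (βc y) - r) := by
      rw [mulVec_add, mulVec_sub, mulVec_smul, mulVec_smul, h₀, h₀', smul_sub]
      abel
    rw [hβ y hyN δ hδ, hΩ y hyN δ hδ, hres, dotProduct_inv_mulVec_smul hdet _ hδ]
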